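/- Let n ∈ ℕ, j ≤ n, and suppose A ⊆ ℝⁿ satisfies A ∈ R(w,ρ0,fine;j) or A ∈ R(s,β,γ;j) for some β ∈ {∅, ρ, ρ0} and γ ∈ Δ := {fine} ∪ (0,1). Then: (a) A is (P^j, j)-rectifiable; and (b) if A has weakly (respectively strongly) locally finite H^j measure, then A has weakly (respectively strongly) locally finite P^j measure. -/

import Mathlib

open Metric Set MeasureTheory ENNReal NNReal

attribute [local instance] Classical.propDecidable

noncomputable section

namespace ReifenbergPaper

/-- The closed `r`-neighbourhood `E^r = {x : dist (x, E) ≤ r}` of `E ⊆ ℝⁿ`. -/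
def nbhd {n : ℕ} (E : Set (EuclideanSpace ℝ (Fin n))) (r : ℝ) :
    Set (EuclideanSpace ℝ (Fin n)) :=
  {x | Metric.infDist x E ≤ r}

/-- The affine plane through `x` with direction the linear subspace `W`. -/
def affPlane {n : ℕ} (x : EuclideanSpace ℝ (Fin n))
    (W : Submodule ℝ (EuclideanSpace ℝ (Fin n))) : Set (EuclideanSpace ℝ (Fin n)) :=
  {z | z - x ∈ W}

/-- `A ∈ R(w,∅,δ;j)`. -/
def RwEmpty {n : ℕ} (j : ℕ) (δ : ℝ) (A : Set (EuclideanSpace ℝ (Fin n))) : Prop :=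
  ∀ y ∈ A, ∃ ρy > (0:ℝ), ∀ ρ ∈ Set.Ioc (0:ℝ) ρy,
    ∃ W : Submodule ℝ (EuclideanSpace ℝ (Fin n)), Module.finrank ℝ W = j ∧
      Metric.closedBall y ρ ∩ A ⊆ nbhd (affPlane y W) (δ * ρ)

/-- `A ∈ R(w,ρ,δ;j)`. -/
def RwRho {n : ℕ} (j : ℕ) (δ : ℝ) (A : Set (EuclideanSpace ℝ (Fin n))) : Prop :=
  ∀ y ∈ A, ∃ ρy > (0:ℝ), ∀ x ∈ Metric.closedBall y ρy ∩ A, ∀ ρ ∈ Set.Ioc (0:ℝ) ρy,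
    ∃ W : Submodule ℝ (EuclideanSpace ℝ (Fin n)), Module.finrank ℝ W = j ∧
      Metric.closedBall x ρ ∩ A ⊆ nbhd (affPlane x W) (δ * ρ)

/-- `A ∈ R(w,ρ0,δ;j)`. -/
def RwRho0 {n : ℕ} (j : ℕ) (δ : ℝ) (A : Set (EuclideanSpace ℝ (Fin n))) : Prop :=
  ∃ ρ0 > (0:ℝ), (∃ c, A ⊆ Metric.closedBall c ρ0) ∧
    ∀ y ∈ A, ∀ ρ ∈ Set.Ioc (0:ℝ) ρ0,
      ∃ W : Submodule ℝ (EuclideanSpace ℝ (Fin n)), Module.finrank ℝ W = j ∧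
        Metric.closedBall y ρ ∩ A ⊆ nbhd (affPlane y W) (δ * ρ)

/-- `A ∈ R(s,∅,δ;j)`. -/
def RsEmpty {n : ℕ} (j : ℕ) (δ : ℝ) (A : Set (EuclideanSpace ℝ (Fin n))) : Prop :=
  ∀ y ∈ A, ∃ ρy > (0:ℝ), ∃ W : Submodule ℝ (EuclideanSpace ℝ (Fin n)),
    Module.finrank ℝ W = j ∧ ∀ ρ ∈ Set.Ioc (0:ℝ) ρy,
      Metric.closedBall y ρ ∩ A ⊆ nbhd (affPlane y W) (δ * ρ)

/-- `A ∈ R(s,ρ,δ;j)`. -/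
def RsRho {n : ℕ} (j : ℕ) (δ : ℝ) (A : Set (EuclideanSpace ℝ (Fin n))) : Prop :=
  ∀ y ∈ A, ∃ ρy > (0:ℝ), ∃ W : Submodule ℝ (EuclideanSpace ℝ (Fin n)),
    Module.finrank ℝ W = j ∧
    ∀ x ∈ Metric.closedBall y ρy ∩ A, ∀ ρ ∈ Set.Ioc (0:ℝ) ρy,
      Metric.closedBall x ρ ∩ A ⊆ nbhd (affPlane x W) (δ * ρ)

/-- `A ∈ R(s,ρ0,δ;j)`. -/
def RsRho0 {n : ℕ} (j : ℕ) (δ : ℝ) (A : Set (EuclideanSpace ℝ (Fin n))) : Prop :=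
  ∃ ρ0 > (0:ℝ), (∃ c, A ⊆ Metric.closedBall c ρ0) ∧
    ∃ W : Submodule ℝ (EuclideanSpace ℝ (Fin n)), Module.finrank ℝ W = j ∧
      ∀ x ∈ A, ∀ ρ ∈ Set.Ioc (0:ℝ) ρ0,
        Metric.closedBall x ρ ∩ A ⊆ nbhd (affPlane x W) (δ * ρ)

/-- The weak/strong parameter `α`. -/
inductive Alpha | w | s

/-- The uniformity parameter `β ∈ {∅, ρ, ρ0}`. -/
inductive Beta | none | rho | rho0

/-- `A ∈ R(α,β,δ;j)` for a fixed approximation constant `δ`. -/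
def RDelta {n : ℕ} (α : Alpha) (β : Beta) (j : ℕ) (δ : ℝ)
    (A : Set (EuclideanSpace ℝ (Fin n))) : Prop :=
  match α, β with
  | .w, .none => RwEmpty j δ A
  | .w, .rho  => RwRho j δ A
  | .w, .rho0 => RwRho0 j δ A
  | .s, .none => RsEmpty j δ A
  | .s, .rho  => RsRho j δ A
  | .s, .rho0 => RsRho0 j δ A

/-- `A ∈ R(α,β,γ;j)` where `γ : Option ℝ`, with `Option.none` denoting the fine
property (`δ`-approximation for every `δ ∈ (0,1)`) and `Option.some δ` denoting the
`δ`-approximation property. -/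
def RGamma {n : ℕ} (α : Alpha) (β : Beta) (j : ℕ) (γ : Option ℝ)
    (A : Set (EuclideanSpace ℝ (Fin n))) : Prop :=
  match γ with
  | Option.none => ∀ δ ∈ Set.Ioo (0:ℝ) 1, RDelta α β j δ A
  | Option.some δ => RDelta α β j δ A

/-- `γ ∈ Δ := {fine} ∪ (0,1)`. -/
def memDelta (γ : Option ℝ) : Prop :=
  γ = Option.none ∨ ∃ d ∈ Set.Ioo (0:ℝ) 1, γ = Option.some d

/-- The graph `{x + g x : x ∈ W}` of a function `g : W → Wᗮ`. -/
def lipGraph {n : ℕ} (W : Submodule ℝ (EuclideanSpace ℝ (Fin n)))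
    (g : W → Wᗮ) : Set (EuclideanSpace ℝ (Fin n)) :=
  {p | ∃ x : W, p = (x : EuclideanSpace ℝ (Fin n)) + (g x : EuclideanSpace ℝ (Fin n))}

/-- `N_ε(E)`: the smallest number of sets of diameter at most `ε` needed to cover `E`,
as an element of `ℝ≥0∞` (`⊤` if no finite cover exists). -/
def coverNum {n : ℕ} (E : Set (EuclideanSpace ℝ (Fin n))) (ε : ℝ) : ℝ≥0∞ :=
  ⨅ (s : Finset (Set (EuclideanSpace ℝ (Fin n)))) (_ : E ⊆ ⋃ t ∈ s, t)
    (_ : ∀ t ∈ s, Metric.diam t ≤ ε), (s.card : ℝ≥0∞)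

/-- Upper Minkowski (box-counting) dimension
`limsup_{ε → 0⁺} log N_ε(E) / (- log ε)`, with the convention that the empty set
has dimension `0`. -/
def upperMinkDim {n : ℕ} (E : Set (EuclideanSpace ℝ (Fin n))) : ℝ :=
  if E = ∅ then 0 else
    Filter.limsup (fun ε : ℝ => Real.log (coverNum E ε).toReal / (-Real.log ε))
      (nhdsWithin 0 (Set.Ioi 0))

/-- Lower Minkowski (box-counting) dimension
`liminf_{ε → 0⁺} log N_ε(E) / (- log ε)`, with the convention that the empty set
has dimension `0`. -/
def lowerMinkDim {n : ℕ} (E : Set (EuclideanSpace ℝ (Fin n))) : ℝ :=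
  if E = ∅ then 0 else
    Filter.liminf (fun ε : ℝ => Real.log (coverNum E ε).toReal / (-Real.log ε))
      (nhdsWithin 0 (Set.Ioi 0))

/-- Packing dimension:
`dim_P A = inf { sup_i dim̄_M A_i : A = ⋃ i, A_i, each A_i bounded }`. -/
def packDim {n : ℕ} (A : Set (EuclideanSpace ℝ (Fin n))) : ℝ :=
  sInf {d : ℝ | ∃ F : ℕ → Set (EuclideanSpace ℝ (Fin n)),
    A = ⋃ i, F i ∧ (∀ i, Bornology.IsBounded (F i)) ∧ ∀ i, upperMinkDim (F i) ≤ d}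

/-- `D` is an `η`-packing of `E`: a countable collection of pairwise disjoint closed
balls centred at points of `E` with (positive) radii at most `η`, coded as a set of
(centre, radius) pairs. -/
def IsPacking {n : ℕ} (η : ℝ) (E : Set (EuclideanSpace ℝ (Fin n)))
    (D : Set (EuclideanSpace ℝ (Fin n) × ℝ)) : Prop :=
  D.Countable ∧ (∀ p ∈ D, p.1 ∈ E ∧ 0 < p.2 ∧ p.2 ≤ η) ∧
    D.Pairwise fun p q => Disjoint (Metric.closedBall p.1 p.2) (Metric.closedBall q.1 q.2)

/-- The packing premeasure `P^s_η(E) = sup { Σ_i (diam B_i)^s }` over `η`-packings. -/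
def packPre {n : ℕ} (s : ℕ) (η : ℝ) (E : Set (EuclideanSpace ℝ (Fin n))) : ℝ≥0∞ :=
  ⨆ (D : Set (EuclideanSpace ℝ (Fin n) × ℝ)) (_ : IsPacking η E D),
    ∑' p : D, (ENNReal.ofReal (Metric.diam (Metric.closedBall p.1.1 p.1.2))) ^ s

/-- `P^s_0(E) = lim_{η ↓ 0} P^s_η(E) = inf_{η > 0} P^s_η(E)`. -/
def packPre0 {n : ℕ} (s : ℕ) (E : Set (EuclideanSpace ℝ (Fin n))) : ℝ≥0∞ :=
  ⨅ (η : ℝ) (_ : 0 < η), packPre s η E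

/-- The `s`-dimensional packing measure
`P^s(E) = inf { Σ_i P^s_0(E_i) : E ⊆ ⋃ i, E_i }`. -/
def packMeasure {n : ℕ} (s : ℕ) (E : Set (EuclideanSpace ℝ (Fin n))) : ℝ≥0∞ :=
  ⨅ (F : ℕ → Set (EuclideanSpace ℝ (Fin n))) (_ : E ⊆ ⋃ i, F i), ∑' i, packPre0 s (F i)

/-- `A` is `(μ, j)`-rectifiable: `A ⊆ M₀ ∪ ⋃ i, f i '' ℝ^j` with `μ M₀ = 0` and each
`f i` Lipschitz. -/
def Rectifiable {n : ℕ} (μ : Set (EuclideanSpace ℝ (Fin n)) → ℝ≥0∞) (j : ℕ)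
    (A : Set (EuclideanSpace ℝ (Fin n))) : Prop :=
  ∃ (M₀ : Set (EuclideanSpace ℝ (Fin n)))
    (f : ℕ → EuclideanSpace ℝ (Fin j) → EuclideanSpace ℝ (Fin n)),
    μ M₀ = 0 ∧ (∀ i, ∃ K : ℝ≥0, LipschitzWith K (f i)) ∧
      A ⊆ M₀ ∪ ⋃ i, Set.range (f i)

/-- `A` has weakly locally finite `μ` measure. -/
def WeaklyLocFinite {n : ℕ} (μ : Set (EuclideanSpace ℝ (Fin n)) → ℝ≥0∞)
    (A : Set (EuclideanSpace ℝ (Fin n))) : Prop :=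
  ∀ y ∈ A, ∃ ρ > (0:ℝ), μ (Metric.closedBall y ρ ∩ A) < ⊤

/-- `A` has strongly locally finite `μ` measure. -/
def StronglyLocFinite {n : ℕ} (μ : Set (EuclideanSpace ℝ (Fin n)) → ℝ≥0∞)
    (A : Set (EuclideanSpace ℝ (Fin n))) : Prop :=
  ∀ K : Set (EuclideanSpace ℝ (Fin n)), IsCompact K → μ (K ∩ A) < ⊤

/-- `A` satisfies the two-sided `wρ j` property with respect to `ε`. -/
def TwoSidedWRho {n : ℕ} (j : ℕ) (ε : ℝ) (A : Set (EuclideanSpace ℝ (Fin n))) : Prop :=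
  ∀ y ∈ A, ∃ ρy > (0:ℝ), ∀ x ∈ A ∩ Metric.closedBall y ρy, ∀ ρ ∈ Set.Ioc (0:ℝ) ρy,
    ∃ (x0 : EuclideanSpace ℝ (Fin n)) (W : Submodule ℝ (EuclideanSpace ℝ (Fin n))),
      Module.finrank ℝ W = j ∧
      Metric.hausdorffDist (A ∩ Metric.closedBall x ρ)
        (affPlane x0 W ∩ Metric.closedBall x ρ) < ε * ρ

/-- The set `N_j = ⋃_{i ≥ 1} {i⁻¹} × [0,1]^j ⊆ ℝ^{j+1}`. -/
def NSet (j : ℕ) : Set (EuclideanSpace ℝ (Fin (j+1))) :=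
  {x | ∃ i : ℕ, 1 ≤ i ∧ x 0 = ((i : ℝ))⁻¹ ∧ ∀ k : Fin (j+1), k ≠ 0 → x k ∈ Set.Icc (0:ℝ) 1}


/-- `T` has norm at most `2` and expands distances on `G` by at least the factor `c`. -/
def IsBilipschitzChart {n j : ℕ} (c : ℝ)
    (T : EuclideanSpace ℝ (Fin n) →L[ℝ] EuclideanSpace ℝ (Fin j))
    (G : Set (EuclideanSpace ℝ (Fin n))) : Prop :=
  ‖T‖ ≤ 2 ∧ ∀ x ∈ G, ∀ y ∈ G, c * dist x y ≤ dist (T x) (T y)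

/-- Near each of its points `y`, the set `A` lies in a cone with apex `y` around a complement
of the kernel of a linear contraction `T` to `ℝ^j`. -/
def HasConeCharts {n : ℕ} (j : ℕ) (c : ℝ) (A : Set (EuclideanSpace ℝ (Fin n))) : Prop :=
  ∀ y ∈ A, ∃ ρ > (0 : ℝ), ∃ T : EuclideanSpace ℝ (Fin n) →L[ℝ] EuclideanSpace ℝ (Fin j),
    ‖T‖ ≤ 1 ∧ ∀ x ∈ A, dist x y ≤ ρ → c * ‖x - y‖ ≤ ‖T (x - y)‖

lemma mul_dist_le_on_closure {X Y : Type*} [PseudoMetricSpace X] [PseudoMetricSpace Y]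
    {c : ℝ} {f : X → Y} (hf : Continuous f) {G : Set X}
    (h : ∀ x ∈ G, ∀ y ∈ G, c * dist x y ≤ dist (f x) (f y)) :
    ∀ x ∈ closure G, ∀ y ∈ closure G, c * dist x y ≤ dist (f x) (f y) := by
  intro x hx y hy
  have hmem : (x, y) ∈ closure (G ×ˢ G) := by
    rw [closure_prod_eq]
    exact ⟨hx, hy⟩
  exact le_on_closure (f := fun p : X × X => c * dist p.1 p.2)
    (g := fun p : X × X => dist (f p.1) (f p.2)) (fun p hp => h p.1 hp.1 p.2 hp.2)
    (by fun_prop) (by fun_prop) hmem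

lemma IsBilipschitzChart.closure {n j : ℕ} {c : ℝ}
    {T : EuclideanSpace ℝ (Fin n) →L[ℝ] EuclideanSpace ℝ (Fin j)}
    {G : Set (EuclideanSpace ℝ (Fin n))} (h : IsBilipschitzChart c T G) :
    IsBilipschitzChart c T (closure G) :=
  ⟨h.1, mul_dist_le_on_closure T.continuous h.2⟩

lemma IsBilipschitzChart.mono {n j : ℕ} {c : ℝ}
    {T : EuclideanSpace ℝ (Fin n) →L[ℝ] EuclideanSpace ℝ (Fin j)}
    {G H : Set (EuclideanSpace ℝ (Fin n))} (h : IsBilipschitzChart c T G) (hHG : H ⊆ G) :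
    IsBilipschitzChart c T H :=
  ⟨h.1, fun x hx y hy => h.2 x (hHG hx) y (hHG hy)⟩

lemma IsBilipschitzChart.subset_range_lipschitz {n j : ℕ} {c : ℝ} (hc : 0 < c)
    {T : EuclideanSpace ℝ (Fin n) →L[ℝ] EuclideanSpace ℝ (Fin j)}
    {G : Set (EuclideanSpace ℝ (Fin n))} (h : IsBilipschitzChart c T G) :
    ∃ f : EuclideanSpace ℝ (Fin j) → EuclideanSpace ℝ (Fin n),
      (∃ K : ℝ≥0, LipschitzWith K f) ∧ G ⊆ range f := by
  have hinj : InjOn T G := by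
    intro x hx y hy hxy
    have h1 := h.2 x hx y hy
    rw [hxy, dist_self] at h1
    exact dist_le_zero.1 (nonpos_of_mul_nonpos_right h1 hc)
  have hlip : LipschitzOnWith (Real.toNNReal c⁻¹) (Function.invFunOn T G) (T '' G) := by
    refine LipschitzOnWith.of_dist_le_mul ?_
    rintro _ ⟨x, hx, rfl⟩ _ ⟨y, hy, rfl⟩
    rw [hinj.leftInvOn_invFunOn hx, hinj.leftInvOn_invFunOn hy,
      Real.coe_toNNReal _ (inv_nonneg.2 hc.le), inv_mul_eq_div, le_div_iff₀' hc]
    exact h.2 x hx y hy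
  obtain ⟨f, hf, hfe⟩ := hlip.extend_finite_dimension
  refine ⟨f, ⟨_, hf⟩, fun x hx => ⟨T x, ?_⟩⟩
  rw [← hfe (mem_image_of_mem T hx), hinj.leftInvOn_invFunOn hx]

lemma HasConeCharts.exists_closed_cover {n j : ℕ} {c : ℝ} (hc : 0 < c) (hc1 : c ≤ 1)
    {A : Set (EuclideanSpace ℝ (Fin n))} (hA : HasConeCharts j c A) :
    ∃ (S : ℕ → Set (EuclideanSpace ℝ (Fin n)))
      (T : ℕ → EuclideanSpace ℝ (Fin n) →L[ℝ] EuclideanSpace ℝ (Fin j)),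
      (∀ i, IsBilipschitzChart (c / 2) (T i) (S i)) ∧ (∀ i, IsClosed (S i)) ∧
        A ⊆ ⋃ i, S i := by
  choose! ρ hρ π hπ hcone using hA
  let u := TopologicalSpace.denseSeq
    (EuclideanSpace ℝ (Fin n) →L[ℝ] EuclideanSpace ℝ (Fin j))
  let z := TopologicalSpace.denseSeq (EuclideanSpace ℝ (Fin n))
  let P : ℕ × ℕ × ℕ → Set (EuclideanSpace ℝ (Fin n)) := fun q =>
    {y ∈ A | dist (π y) (u q.1) < c / 2 ∧ 1 / ((q.2.1 : ℝ) + 1) < ρ y ∧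
      dist y (z q.2.2) < 1 / ((q.2.1 : ℝ) + 1) / 2}
  have hP : ∀ q, ∃ T : EuclideanSpace ℝ (Fin n) →L[ℝ] EuclideanSpace ℝ (Fin j),
      IsBilipschitzChart (c / 2) T (P q) := by
    intro q
    by_cases hne : (P q).Nonempty
    · refine ⟨u q.1, ?_, ?_⟩
      · obtain ⟨y, hyA, hy, -⟩ := hne
        have h1 := hπ y hyA
        have h2 := norm_le_norm_add_norm_sub (π y) (u q.1)
        rw [dist_eq_norm] at hy
        linarith
      · rintro x ⟨hxA, -, -, hxz⟩ y ⟨hyA, hy, hyρ, hyz⟩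
        have hxy : dist x y ≤ ρ y := by
          linarith [dist_triangle_right x y (z q.2.2)]
        have h1 := hcone y hyA x hxA hxy
        have h2 : ‖(π y - u q.1) (x - y)‖ ≤ c / 2 * ‖x - y‖ :=
          ((π y - u q.1).le_opNorm _).trans (by
            rw [← dist_eq_norm]
            gcongr)
        have h3 : ‖π y (x - y)‖ ≤ ‖(π y - u q.1) (x - y)‖ + ‖u q.1 (x - y)‖ := by
          rw [sub_apply]
          exact norm_le_norm_sub_add _ _
        rw [dist_eq_norm, dist_eq_norm, ← map_sub]
        linarith
    · rw [not_nonempty_iff_eq_empty] at hne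
      exact ⟨0, by simp, by simp [hne]⟩
  choose T hT using hP
  let e := (Denumerable.eqv (ℕ × ℕ × ℕ)).symm
  refine ⟨fun i => closure (P (e i)), fun i => T (e i), fun i => (hT _).closure,
    fun i => isClosed_closure, fun y hy => ?_⟩
  obtain ⟨i, hi⟩ := (TopologicalSpace.denseRange_denseSeq
    (EuclideanSpace ℝ (Fin n) →L[ℝ] EuclideanSpace ℝ (Fin j))).exists_dist_lt (π y)
    (half_pos hc)
  obtain ⟨k, hk⟩ := exists_nat_one_div_lt (hρ y hy)
  obtain ⟨l, hl⟩ := (TopologicalSpace.denseRange_denseSeq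
    (EuclideanSpace ℝ (Fin n))).exists_dist_lt y
    (show 0 < 1 / ((k : ℝ) + 1) / 2 by positivity)
  refine mem_iUnion.2 ⟨e.symm (i, k, l), subset_closure ?_⟩
  rw [Equiv.apply_symm_apply]
  exact ⟨hy, hi, hk, hl⟩

lemma packPre0_empty {n : ℕ} (s : ℕ) :
    packPre0 s (∅ : Set (EuclideanSpace ℝ (Fin n))) = 0 := by
  refine le_antisymm (iInf₂_le_of_le 1 one_pos (iSup₂_le fun D hD => ?_)) zero_le
  have : D = ∅ := eq_empty_of_forall_notMem fun p hp => (hD.2.1 p hp).1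
  subst this
  simp

lemma packMeasure_eq_ofFunction {n : ℕ} (s : ℕ) (E : Set (EuclideanSpace ℝ (Fin n))) :
    packMeasure s E = OuterMeasure.ofFunction (packPre0 s) (packPre0_empty s) E :=
  (OuterMeasure.ofFunction_apply _ _ _).symm

lemma packMeasure_iUnion_le {n : ℕ} (s : ℕ) (F : ℕ → Set (EuclideanSpace ℝ (Fin n))) :
    packMeasure s (⋃ i, F i) ≤ ∑' i, packMeasure s (F i) := by
  simp only [packMeasure_eq_ofFunction]
  exact measure_iUnion_le _

/-- Disjointness of the images of packing balls under a chart bounds the packing sum by volume. -/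
lemma IsBilipschitzChart.packPre_le {n j : ℕ} {c : ℝ} (hc : 0 < c) (hc1 : c ≤ 1)
    {T : EuclideanSpace ℝ (Fin n) →L[ℝ] EuclideanSpace ℝ (Fin j)}
    {G : Set (EuclideanSpace ℝ (Fin n))} (h : IsBilipschitzChart c T G)
    {x₀ : EuclideanSpace ℝ (Fin n)} {d : ℝ} (hd : 0 ≤ d) (hG : ∀ x ∈ G, dist x x₀ ≤ d)
    {η : ℝ} (hη : 0 < η) :
    packPre j η G ≤ ENNReal.ofReal (8 / c * (d + η)) ^ j := by
  refine iSup₂_le fun D hD => ?_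
  obtain ⟨hDc, hDm, hDd⟩ := hD
  have : Countable D := hDc.to_subtype
  let U : D → Set (EuclideanSpace ℝ (Fin j)) := fun p => ball (T p.1.1) (c / 2 * p.1.2)
  have hdisj : Pairwise (Function.onFun Disjoint U) := by
    intro p q hpq
    have hpq' := hDd p.2 q.2 (fun he => hpq (Subtype.ext he))
    obtain ⟨hp, hp0, -⟩ := hDm p p.2
    obtain ⟨hq, hq0, -⟩ := hDm q q.2
    have h1 : p.1.2 < dist p.1.1 q.1.1 := by
      by_contra! hle
      exact disjoint_left.1 hpq' (mem_closedBall'.2 hle) (mem_closedBall_self hq0.le)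
    have h2 : q.1.2 < dist p.1.1 q.1.1 := by
      by_contra! hle
      exact disjoint_left.1 hpq' (mem_closedBall_self hp0.le) (mem_closedBall.2 hle)
    refine ball_disjoint_ball ((?_ : _ ≤ c * dist p.1.1 q.1.1).trans (h.2 _ hp _ hq))
    nlinarith
  have hsub : ⋃ p, U p ⊆ ball (T x₀) (2 * (d + η)) := by
    refine iUnion_subset fun p => ball_subset_ball' ?_
    obtain ⟨hp, hp0, hpη⟩ := hDm p p.2
    have h1 : dist (T p.1.1) (T x₀) ≤ 2 * d := by
      rw [dist_eq_norm, ← map_sub]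
      refine (T.le_opNorm _).trans ?_
      rw [← dist_eq_norm]
      exact mul_le_mul h.1 (hG _ hp) dist_nonneg zero_le_two
    nlinarith
  have hball : ∀ (x : EuclideanSpace ℝ (Fin j)) {r : ℝ}, 0 < r →
      volume (ball x r) = ENNReal.ofReal r ^ j * volume (ball (0 : EuclideanSpace ℝ (Fin j)) 1) :=
    fun x r hr => by
      rw [Measure.addHaar_ball_of_pos _ _ hr, finrank_euclideanSpace_fin,
        ENNReal.ofReal_pow hr.le]
  have hvol : (∑' p : D, ENNReal.ofReal (c / 2 * p.1.2) ^ j) ≤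
      ENNReal.ofReal (2 * (d + η)) ^ j := by
    have h1 := (tsum_meas_le_meas_iUnion_of_disjoint volume (fun p => measurableSet_ball)
      hdisj).trans (measure_mono hsub)
    rw [hball _ (by positivity), tsum_congr fun p : D => hball (T p.1.1)
      (_root_.mul_pos (half_pos hc) (hDm p.1 p.2).2.1), ENNReal.tsum_mul_right] at h1
    exact (ENNReal.mul_le_mul_iff_left (measure_ball_pos _ _ one_pos).ne'
      measure_ball_lt_top.ne).1 h1
  calc ∑' p : D, ENNReal.ofReal (Metric.diam (closedBall p.1.1 p.1.2)) ^ j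
      ≤ ∑' p : D, ENNReal.ofReal (4 / c) ^ j * ENNReal.ofReal (c / 2 * p.1.2) ^ j := by
        refine ENNReal.tsum_le_tsum fun p => ?_
        rw [← mul_pow, ← ENNReal.ofReal_mul (by positivity)]
        gcongr
        refine (Metric.diam_closedBall (hDm p.1 p.2).2.1.le).trans_eq ?_
        field_simp
        ring
    _ ≤ ENNReal.ofReal (4 / c) ^ j * ENNReal.ofReal (2 * (d + η)) ^ j := by
        rw [ENNReal.tsum_mul_left]
        gcongr
    _ = ENNReal.ofReal (8 / c * (d + η)) ^ j := by
        rw [← mul_pow, ← ENNReal.ofReal_mul (by positivity)]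
        congr 2
        ring

lemma IsBilipschitzChart.packPre0_le {n j : ℕ} {c : ℝ} (hc : 0 < c) (hc1 : c ≤ 1)
    {T : EuclideanSpace ℝ (Fin n) →L[ℝ] EuclideanSpace ℝ (Fin j)}
    {G : Set (EuclideanSpace ℝ (Fin n))} (h : IsBilipschitzChart c T G)
    (hne : G.Nonempty) (hfin : ediam G ≠ ⊤) :
    packPre0 j G ≤ ENNReal.ofReal (8 / c) ^ j * ediam G ^ j := by
  obtain ⟨x₀, hx₀⟩ := hne
  have hdiam : ∀ x ∈ G, dist x x₀ ≤ Metric.diam G := fun x hx => by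
    rw [dist_edist]
    exact ENNReal.toReal_mono hfin (edist_le_ediam_of_mem hx hx₀)
  have hlim : Filter.Tendsto
      (fun η : ℝ => ENNReal.ofReal (8 / c * (Metric.diam G + η)) ^ j)
      (nhdsWithin 0 (Ioi 0)) (nhds (ENNReal.ofReal (8 / c * (Metric.diam G + 0)) ^ j)) := by
    refine (Continuous.tendsto ?_ 0).mono_left nhdsWithin_le_nhds
    exact (ENNReal.continuous_pow j).comp (ENNReal.continuous_ofReal.comp (by fun_prop))
  have hle := ge_of_tendsto hlim (b := packPre0 j G) (by
    filter_upwards [self_mem_nhdsWithin] with η hη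
    exact (iInf₂_le η hη).trans (h.packPre_le hc hc1 Metric.diam_nonneg hdiam hη))
  rwa [add_zero, ENNReal.ofReal_mul (by positivity), mul_pow, Metric.diam,
    ENNReal.ofReal_toReal hfin] at hle

lemma IsBilipschitzChart.packMeasure_le {n j : ℕ} {c : ℝ} (hc : 0 < c) (hc1 : c ≤ 1)
    {T : EuclideanSpace ℝ (Fin n) →L[ℝ] EuclideanSpace ℝ (Fin j)}
    {G : Set (EuclideanSpace ℝ (Fin n))} (h : IsBilipschitzChart c T G) :
    packMeasure j G ≤ ENNReal.ofReal (8 / c) ^ j * μH[(j : ℝ)] G := by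
  have hK0 : ENNReal.ofReal (8 / c) ^ j ≠ 0 :=
    pow_ne_zero _ (ENNReal.ofReal_pos.2 (by positivity)).ne'
  have hKtop : ENNReal.ofReal (8 / c) ^ j ≠ ⊤ := ENNReal.pow_ne_top ENNReal.ofReal_ne_top
  rw [mul_comm, ← ENNReal.div_le_iff_le_mul (Or.inl hK0) (Or.inl hKtop),
    Measure.hausdorffMeasure_apply]
  refine le_iSup₂_of_le 1 one_pos (le_iInf fun t => le_iInf fun ht => le_iInf fun hdt => ?_)
  refine ENNReal.div_le_of_le_mul' ?_
  have hcov : G ⊆ ⋃ i, G ∩ t i := by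
    rw [← inter_iUnion]
    exact subset_inter subset_rfl ht
  refine (iInf₂_le (fun i => G ∩ t i) hcov).trans ?_
  rw [← ENNReal.tsum_mul_left]
  refine ENNReal.tsum_le_tsum fun i => ?_
  rcases (G ∩ t i).eq_empty_or_nonempty with he | hne
  · simp [he, packPre0_empty]
  · have hdiam : ediam (G ∩ t i) ≤ ediam (t i) := ediam_mono inter_subset_right
    refine ((h.mono inter_subset_left).packPre0_le hc hc1 hne
      ((hdiam.trans (hdt i)).trans_lt ENNReal.one_lt_top).ne).trans ?_
    rw [iSup_pos (hne.mono inter_subset_right), ENNReal.rpow_natCast]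
    gcongr

lemma HasConeCharts.packMeasure_le {n j : ℕ} {c : ℝ} (hc : 0 < c) (hc1 : c ≤ 1)
    {A : Set (EuclideanSpace ℝ (Fin n))} (hA : HasConeCharts j c A)
    {X : Set (EuclideanSpace ℝ (Fin n))} (hX : X ⊆ A) :
    packMeasure j X ≤ ENNReal.ofReal (8 / (c / 2)) ^ j * μH[(j : ℝ)] X := by
  obtain ⟨S, T, hST, hS, hAS⟩ := hA.exists_closed_cover hc hc1
  have hmeas : ∀ i, MeasurableSet (disjointed S i) :=
    MeasurableSet.disjointed fun i => (hS i).measurableSet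
  have hXS : X = ⋃ i, disjointed S i ∩ X := by
    rw [← iUnion_inter, iUnion_disjointed, inter_eq_right.2 (hX.trans hAS)]
  calc packMeasure j X = packMeasure j (⋃ i, disjointed S i ∩ X) := by rw [← hXS]
    _ ≤ ∑' i, packMeasure j (disjointed S i ∩ X) := packMeasure_iUnion_le _ _
    _ ≤ ∑' i, ENNReal.ofReal (8 / (c / 2)) ^ j * μH[(j : ℝ)] (disjointed S i ∩ X) :=
        ENNReal.tsum_le_tsum fun i => ((hST i).mono (inter_subset_left.trans
          (disjointed_subset S i))).packMeasure_le (half_pos hc) (by linarith)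
    _ = ENNReal.ofReal (8 / (c / 2)) ^ j *
          ∑' i, (μH[(j : ℝ)]).restrict X (disjointed S i) := by
        rw [ENNReal.tsum_mul_left]
        simp only [Measure.restrict_apply (hmeas _)]
    _ ≤ ENNReal.ofReal (8 / (c / 2)) ^ j * μH[(j : ℝ)] X := by
        gcongr
        refine (tsum_measure_le_measure_univ (fun i => (hmeas i).nullMeasurableSet)
          fun a b hab => (disjoint_disjointed S hab).aedisjoint).trans_eq ?_
        rw [Measure.restrict_apply_univ]

lemma HasConeCharts.rectifiable {n j : ℕ} {c : ℝ} (hc : 0 < c) (hc1 : c ≤ 1)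
    {A : Set (EuclideanSpace ℝ (Fin n))} (hA : HasConeCharts j c A) :
    Rectifiable (packMeasure j) j A := by
  obtain ⟨S, T, hST, -, hAS⟩ := hA.exists_closed_cover hc hc1
  choose f hf hSf using fun i => (hST i).subset_range_lipschitz (half_pos hc)
  refine ⟨∅, f, ?_, hf, ?_⟩
  · rw [packMeasure_eq_ofFunction]
    exact measure_empty
  · rw [empty_union]
    exact hAS.trans (iUnion_mono hSf)

/-- The orthogonal projection onto `W`, read in an orthonormal basis of `W`. -/
lemma exists_contraction_of_finrank_eq {n j : ℕ}
    {W : Submodule ℝ (EuclideanSpace ℝ (Fin n))} (hW : Module.finrank ℝ W = j) :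
    ∃ T : EuclideanSpace ℝ (Fin n) →L[ℝ] EuclideanSpace ℝ (Fin j), ‖T‖ ≤ 1 ∧
      ∀ x y : EuclideanSpace ℝ (Fin n), ∀ t : ℝ, x ∈ nbhd (affPlane y W) t →
        ‖x - y‖ - t ≤ ‖T (x - y)‖ := by
  let e : W ≃ₗᵢ[ℝ] EuclideanSpace ℝ (Fin j) :=
    ((stdOrthonormalBasis ℝ W).reindex (finCongr hW)).repr
  let T : EuclideanSpace ℝ (Fin n) →L[ℝ] EuclideanSpace ℝ (Fin j) :=
    e.toContinuousLinearEquiv.toContinuousLinearMap ∘L W.orthogonalProjectionOnto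
  have hT : ∀ v, ‖T v‖ = ‖W.starProjection v‖ := fun v => by
    rw [Submodule.starProjection_apply]
    exact e.norm_map _
  refine ⟨T, T.opNorm_le_bound zero_le_one fun v => ?_, fun x y t hx => ?_⟩
  · rw [hT]
    exact W.starProjection.le_of_opNorm_le W.starProjection_norm_le v
  · have hproj : ‖(x - y) - W.starProjection (x - y)‖ ≤ infDist x (affPlane y W) := by
      refine (le_infDist ⟨y, by simp [affPlane]⟩).2 fun z hz => ?_
      rw [Submodule.starProjection_minimal, dist_eq_norm]
      refine (ciInf_le ⟨0, forall_mem_range.2 fun _ => norm_nonneg _⟩ ⟨z - y, hz⟩).trans_eq ?_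
      simp
    rw [hT]
    have h1 := norm_le_norm_sub_add (x - y) (W.starProjection (x - y))
    linarith [hproj.trans hx]

lemma RsEmpty.hasConeCharts {n j : ℕ} {δ : ℝ} {A : Set (EuclideanSpace ℝ (Fin n))}
    (hA : RsEmpty j δ A) : HasConeCharts j (1 - δ) A := by
  intro y hy
  obtain ⟨ρ, hρ, W, hW, hAW⟩ := hA y hy
  obtain ⟨T, hT, hcone⟩ := exists_contraction_of_finrank_eq hW
  refine ⟨ρ, hρ, T, hT, fun x hx hxy => ?_⟩
  rcases eq_or_ne x y with rfl | hne
  · simp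
  · have h1 := hcone x y _ (hAW (dist x y) ⟨dist_pos.2 hne, hxy⟩
      ⟨mem_closedBall.2 le_rfl, hx⟩)
    rw [dist_eq_norm] at h1
    linarith

lemma RDelta.rsEmpty {n j : ℕ} {β : Beta} {δ : ℝ} {A : Set (EuclideanSpace ℝ (Fin n))}
    (hA : RDelta .s β j δ A) : RsEmpty j δ A := by
  cases β with
  | none => exact hA
  | rho =>
    intro y hy
    obtain ⟨ρ, hρ, W, hW, h⟩ := hA y hy
    exact ⟨ρ, hρ, W, hW, h y ⟨mem_closedBall_self hρ.le, hy⟩⟩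
  | rho0 =>
    intro y hy
    obtain ⟨ρ, hρ, -, W, hW, h⟩ := hA
    exact ⟨ρ, hρ, W, hW, h y hy⟩

/-- The scale in the fine uniform weak property is at least half the diameter of `A`, whatever the
approximation constant, so by compactness `A` is locally contained in `j`-planes. -/
lemma hasConeCharts_of_fine_weak {n j : ℕ} {A : Set (EuclideanSpace ℝ (Fin n))}
    (hA : ∀ δ ∈ Ioo (0 : ℝ) 1, RwRho0 j δ A) : HasConeCharts j 1 A := by
  intro y hy
  rcases A.subsingleton_or_nontrivial with hsub | ⟨p, hp, q, hq, hpq⟩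
  · refine ⟨1, one_pos, 0, by simp, fun x hx _ => ?_⟩
    simp [hsub hx hy]
  set r : ℝ := dist p q / 2
  have hr : 0 < r := half_pos (dist_pos.2 hpq)
  have happrox : ∀ k : ℕ,
      ∃ T : EuclideanSpace ℝ (Fin n) →L[ℝ] EuclideanSpace ℝ (Fin j), ‖T‖ ≤ 1 ∧
        ∀ x ∈ A, dist x y ≤ r → ‖x - y‖ - 1 / ((k : ℝ) + 1) / 2 * r ≤ ‖T (x - y)‖ := by
    intro k
    have hk : 1 / ((k : ℝ) + 1) / 2 < 1 := by
      have : 1 / ((k : ℝ) + 1) ≤ 1 := by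
        rw [div_le_one (by positivity)]
        linarith [k.cast_nonneg (α := ℝ)]
      linarith
    obtain ⟨ρ, hρ, ⟨c, hc⟩, h⟩ := hA (1 / ((k : ℝ) + 1) / 2) ⟨by positivity, hk⟩
    have hrρ : r ≤ ρ := by
      have h1 := mem_closedBall.1 (hc hp)
      have h2 := mem_closedBall.1 (hc hq)
      have h3 := dist_triangle_right p q c
      simp only [r]
      linarith
    obtain ⟨W, hW, hAW⟩ := h y hy r ⟨hr, hrρ⟩
    obtain ⟨T, hT, hcone⟩ := exists_contraction_of_finrank_eq hW
    exact ⟨T, hT, fun x hx hxy => hcone x y _ (hAW ⟨hxy, hx⟩)⟩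
  choose T hT hTA using happrox
  obtain ⟨S, hS, φ, hφ, hlim⟩ :=
    (isCompact_closedBall (0 : EuclideanSpace ℝ (Fin n) →L[ℝ] EuclideanSpace ℝ (Fin j))
      1).tendsto_subseq (x := T) fun k => by simpa using hT k
  refine ⟨r, hr, S, by simpa using hS, fun x hx hxy => ?_⟩
  have hleft : Filter.Tendsto (fun k => ‖x - y‖ - 1 / ((φ k : ℝ) + 1) / 2 * r) Filter.atTop
      (nhds (‖x - y‖ - 0 / 2 * r)) :=
    (((tendsto_one_div_add_atTop_nhds_zero_nat.comp hφ.tendsto_atTop).div_const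
      2).mul_const r).const_sub _
  have hright : Filter.Tendsto (fun k => ‖T (φ k) (x - y)‖) Filter.atTop
      (nhds ‖S (x - y)‖) :=
    (((ContinuousLinearMap.apply ℝ (EuclideanSpace ℝ (Fin j)) (x - y)).continuous.tendsto
      S).comp hlim).norm
  simpa using le_of_tendsto_of_tendsto' hleft hright fun k => hTA (φ k) x hx hxy

/-- for a set with the `ρ0`-uniform fine weak property or any strong
Reifenberg property: (a) `A` is `(P^j, j)`-rectifiable; (b) weakly (resp. strongly)
locally finite `H^j` measure implies weakly (resp. strongly) locally finite `P^j`
measure. -/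
theorem pack_rectifiable_and_locally_finite (n j : ℕ) (hj : j ≤ n)
    (A : Set (EuclideanSpace ℝ (Fin n)))
    (hA : RGamma .w .rho0 j Option.none A ∨
      ∃ (β : Beta) (γ : Option ℝ), memDelta γ ∧ RGamma .s β j γ A) :
    Rectifiable (packMeasure j) j A ∧
      (WeaklyLocFinite (fun S => μH[(j : ℝ)] S) A → WeaklyLocFinite (packMeasure j) A) ∧
      (StronglyLocFinite (fun S => μH[(j : ℝ)] S) A →
        StronglyLocFinite (packMeasure j) A) := by
  obtain ⟨c, hc, hc1, hcone⟩ : ∃ c : ℝ, 0 < c ∧ c ≤ 1 ∧ HasConeCharts j c A := by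
    rcases hA with hA | ⟨β, γ, rfl | ⟨δ, hδ, rfl⟩, hA⟩
    · exact ⟨1, one_pos, le_rfl, hasConeCharts_of_fine_weak hA⟩
    · have hhalf : RDelta .s β j (1 / 2) A := hA (1 / 2) ⟨by norm_num, by norm_num⟩
      exact ⟨1 - 1 / 2, by norm_num, by norm_num, hhalf.rsEmpty.hasConeCharts⟩
    · have hRδ : RDelta .s β j δ A := hA
      exact ⟨1 - δ, by linarith [hδ.2], by linarith [hδ.1], hRδ.rsEmpty.hasConeCharts⟩
  have hfin : ∀ B : Set (EuclideanSpace ℝ (Fin n)),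
      μH[(j : ℝ)] (B ∩ A) < ⊤ → packMeasure j (B ∩ A) < ⊤ := fun B hB =>
    (hcone.packMeasure_le hc hc1 inter_subset_right).trans_lt
      (ENNReal.mul_lt_top (ENNReal.pow_lt_top ENNReal.ofReal_lt_top) hB)
  refine ⟨hcone.rectifiable hc hc1, fun h y hy => ?_, fun h K hK => hfin K (h K hK)⟩
  obtain ⟨ρ, hρ, hlt⟩ := h y hy
  exact ⟨ρ, hρ, hfin _ hlt⟩

end ReifenbergPaper
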